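/- Assume f_ρ(β) ≤ 0. Then every positive solution u of equation (E) in Ω∖{0} satisfies |x|^β u(x) → 0 as |x| → 0. -/

import Mathlib

open MeasureTheory Filter Topology Real RealInnerProductSpace

noncomputable section

/-- The gradient factor `G_τ(x,z,ξ) = z^τ ‖ξ‖^(1-τ) / ‖x‖^(τ+1)`.
For `τ = 0` this equals `‖ξ‖ / ‖x‖`, since `z ^ (0:ℝ) = 1` for real powers. -/
def Gt {N : ℕ} (τ : ℝ) (x : EuclideanSpace ℝ (Fin N)) (z : ℝ)
    (ξ : EuclideanSpace ℝ (Fin N)) : ℝ :=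
  z ^ τ * ‖ξ‖ ^ (1 - τ) / ‖x‖ ^ (τ + 1)

/-- Test functions: `C¹` functions with compact support contained in `Ω \ {0}`. -/
def IsTestFun {N : ℕ} (Ω : Set (EuclideanSpace ℝ (Fin N)))
    (φ : EuclideanSpace ℝ (Fin N) → ℝ) : Prop :=
  ContDiff ℝ 1 φ ∧ HasCompactSupport φ ∧ tsupport φ ⊆ Ω \ {0}

/-- The distributional pairing of equation (E) with a test function `φ`:
`∫ ∇u·∇φ + (N-2+2ρ) ∫ ((x·∇u)/|x|²) φ - λ ∫ G_τ(x,u,∇u) φ + ∫ |x|^θ u^q φ`. -/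
def weakE (N : ℕ) (ρ lam τ θ q : ℝ) (Ω : Set (EuclideanSpace ℝ (Fin N)))
    (u φ : EuclideanSpace ℝ (Fin N) → ℝ) : ℝ :=
  (∫ x in Ω \ {0}, ⟪gradient u x, gradient φ x⟫)
    + ((N : ℝ) - 2 + 2 * ρ) * (∫ x in Ω \ {0}, ⟪x, gradient u x⟫ / ‖x‖ ^ 2 * φ x)
    - lam * (∫ x in Ω \ {0}, Gt τ x (u x) (gradient u x) * φ x)
    + ∫ x in Ω \ {0}, ‖x‖ ^ θ * u x ^ q * φ x

/-- A positive `C¹` function on `Ω \ {0}`. -/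
def PosC1 {N : ℕ} (Ω : Set (EuclideanSpace ℝ (Fin N)))
    (u : EuclideanSpace ℝ (Fin N) → ℝ) : Prop :=
  ContDiffOn ℝ 1 u (Ω \ {0}) ∧ ∀ x ∈ Ω \ {0}, 0 < u x

/-- Positive distributional solution of equation (E) in `Ω \ {0}`. -/
def IsSolutionE (N : ℕ) (ρ lam τ θ q : ℝ) (Ω : Set (EuclideanSpace ℝ (Fin N)))
    (u : EuclideanSpace ℝ (Fin N) → ℝ) : Prop :=
  PosC1 Ω u ∧ ∀ φ, IsTestFun Ω φ → weakE N ρ lam τ θ q Ω u φ = 0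

/-- Positive sub-solution of equation (E) in `Ω \ {0}`. -/
def IsSubSolutionE (N : ℕ) (ρ lam τ θ q : ℝ) (Ω : Set (EuclideanSpace ℝ (Fin N)))
    (u : EuclideanSpace ℝ (Fin N) → ℝ) : Prop :=
  PosC1 Ω u ∧ ∀ φ, IsTestFun Ω φ → (∀ x, 0 ≤ φ x) → weakE N ρ lam τ θ q Ω u φ ≤ 0

/-- Positive super-solution of equation (E) in `Ω \ {0}`. -/
def IsSuperSolutionE (N : ℕ) (ρ lam τ θ q : ℝ) (Ω : Set (EuclideanSpace ℝ (Fin N)))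
    (u : EuclideanSpace ℝ (Fin N) → ℝ) : Prop :=
  PosC1 Ω u ∧ ∀ φ, IsTestFun Ω φ → (∀ x, 0 ≤ φ x) → 0 ≤ weakE N ρ lam τ θ q Ω u φ

/-- `f_ρ(t) = t (t + 2ρ) + λ |t|^(1-τ)`. -/
def fRho (ρ lam τ t : ℝ) : ℝ := t * (t + 2 * ρ) + lam * |t| ^ (1 - τ)

/-- `Υ = ((τ+1)/(2τ)) (λτ)^(1/(τ+1))`. -/
def Upsilon (lam τ : ℝ) : ℝ := ((τ + 1) / (2 * τ)) * (lam * τ) ^ (1 / (τ + 1))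

/-- Case [N₀]: (a) `τ = 0` and `λ ≥ 2ρ`, or (b) `λ > 0`, `τ ∈ (0,1)` and `ρ < Υ`. -/
def CaseN0 (ρ lam τ : ℝ) : Prop :=
  (τ = 0 ∧ 2 * ρ ≤ lam) ∨ (0 < lam ∧ 0 < τ ∧ τ < 1 ∧ ρ < Upsilon lam τ)

/-- Case [N₁]: (a) `τ = 0` and `λ < 2ρ`, or (b) `λ < 0` and `τ ∈ (0,1)`. -/
def CaseN1 (ρ lam τ : ℝ) : Prop :=
  (τ = 0 ∧ lam < 2 * ρ) ∨ (lam < 0 ∧ 0 < τ ∧ τ < 1)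

/-- Case [N₂]: `λ > 0`, `τ ∈ (0,1)` and `ρ ≥ Υ`. -/
def CaseN2 (ρ lam τ : ℝ) : Prop :=
  0 < lam ∧ 0 < τ ∧ τ < 1 ∧ Upsilon lam τ ≤ ρ

/-- `w` is the smallest negative root of `f_ρ` (i.e. `w = ϖ₁`). -/
def IsMinNegRoot (ρ lam τ w : ℝ) : Prop :=
  w < 0 ∧ fRho ρ lam τ w = 0 ∧ ∀ t, t < 0 → fRho ρ lam τ t = 0 → w ≤ t

/-- `w` is the largest negative root of `f_ρ` (i.e. `w = ϖ₂`). -/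
def IsMaxNegRoot (ρ lam τ w : ℝ) : Prop :=
  w < 0 ∧ fRho ρ lam τ w = 0 ∧ ∀ t, t < 0 → fRho ρ lam τ t = 0 → t ≤ w

/-- `Φ_{ϖ₂}(r)`: equal to `r^(-ϖ₂)` if `ρ > Υ` and to `r^(-ϖ₂) |log r|^(2/(1+τ))` if `ρ = Υ`. -/
def Phi2 (ρ lam τ w2 r : ℝ) : ℝ :=
  if ρ = Upsilon lam τ then r ^ (-w2) * |Real.log r| ^ (2 / (1 + τ)) else r ^ (-w2)

/-- `Ψ_{ϖ₁}(t)`: equal to `t^(-ϖ₁)` if `ρ > Υ` and to `t^(-ϖ₁) (log t)^(2/(1+τ))` if `ρ = Υ`. -/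
def Psi1 (ρ lam τ w1 t : ℝ) : ℝ :=
  if ρ = Upsilon lam τ then t ^ (-w1) * (Real.log t) ^ (2 / (1 + τ)) else t ^ (-w1)

/-- The radial operator `L_{ρ,λ,τ}[P](r) = P'' + (1-2ρ) P'/r + λ P^τ |P'|^(1-τ)/r^(1+τ)`. -/
def Lrad (ρ lam τ : ℝ) (P : ℝ → ℝ) (r : ℝ) : ℝ :=
  deriv (deriv P) r + (1 - 2 * ρ) * deriv P r / r
    + lam * P r ^ τ * |deriv P r| ^ (1 - τ) / r ^ (1 + τ)

/-- The Laplacian of `u` at `x`, as the trace of the second derivative. -/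
def lapl {N : ℕ} (u : EuclideanSpace ℝ (Fin N) → ℝ) (x : EuclideanSpace ℝ (Fin N)) : ℝ :=
  ∑ i : Fin N, iteratedFDeriv ℝ 2 u x ![EuclideanSpace.single i 1, EuclideanSpace.single i 1]

/-- The divergence of a vector field on `ℝ^N`. -/
def divergence {N : ℕ} (V : EuclideanSpace ℝ (Fin N) → EuclideanSpace ℝ (Fin N))
    (x : EuclideanSpace ℝ (Fin N)) : ℝ :=
  ∑ i, fderiv ℝ V x (EuclideanSpace.single i 1) i

section Cutoff

variable {E : Type*} [TopologicalSpace E] {U : Set E} {F φ : E → ℝ}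

lemma continuous_mul_of_tsupport_subset (hU : IsOpen U) (hF : ContinuousOn F U)
    (hφ : Continuous φ) (hsupp : tsupport φ ⊆ U) : Continuous fun x => F x * φ x := by
  refine continuous_of_tsupport fun x hx => ?_
  have hxU : x ∈ U := hsupp (tsupport_mul_subset_right hx)
  exact (hF.continuousAt (hU.mem_nhds hxU)).mul hφ.continuousAt

lemma integrable_mul_of_tsupport_subset [MeasurableSpace E] [OpensMeasurableSpace E]
    {μ : Measure E} [IsFiniteMeasureOnCompacts μ]
    (hU : IsOpen U) (hF : ContinuousOn F U) (hφ : Continuous φ)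
    (hc : HasCompactSupport φ) (hsupp : tsupport φ ⊆ U) : Integrable (fun x => F x * φ x) μ :=
  (continuous_mul_of_tsupport_subset hU hF hφ hsupp).integrable_of_hasCompactSupport hc.mul_left

end Cutoff

section Touching

variable {N : ℕ} {U : Set (EuclideanSpace ℝ (Fin N))}

lemma continuousOn_divergence {V : EuclideanSpace ℝ (Fin N) → EuclideanSpace ℝ (Fin N)}
    (hU : IsOpen U) (hV : ContDiffOn ℝ 1 V U) : ContinuousOn (divergence V) U := by
  refine continuousOn_finsetSum _ fun i _ => ?_
  have h1 : ContinuousOn (fun x => fderiv ℝ V x (EuclideanSpace.single i 1)) U :=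
    (hV.continuousOn_fderiv_of_isOpen hU le_rfl).clm_apply continuousOn_const
  exact (EuclideanSpace.proj (𝕜 := ℝ) i).continuous.comp_continuousOn h1

lemma continuousOn_gradient {u : EuclideanSpace ℝ (Fin N) → ℝ}
    (hU : IsOpen U) (hu : ContDiffOn ℝ 1 u U) : ContinuousOn (gradient u) U :=
  (InnerProductSpace.toDual ℝ (EuclideanSpace ℝ (Fin N))).symm.continuous.comp_continuousOn
    (hu.continuousOn_fderiv_of_isOpen hU le_rfl)

lemma integral_inner_gradient_eq_neg_integral_divergence_mul
    {V : EuclideanSpace ℝ (Fin N) → EuclideanSpace ℝ (Fin N)} {φ : EuclideanSpace ℝ (Fin N) → ℝ}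
    (hU : IsOpen U) (hV : ContDiffOn ℝ 1 V U) (hφ : ContDiff ℝ 1 φ)
    (hc : HasCompactSupport φ) (hsupp : tsupport φ ⊆ U) :
    ∫ x, ⟪V x, gradient φ x⟫ = -∫ x, divergence V x * φ x := by
  have hcoord (i : Fin N) : ContDiffOn ℝ 1 (fun x => V x i) U :=
    (EuclideanSpace.proj (𝕜 := ℝ) i).contDiff.comp_contDiffOn hV
  have hderiv (i : Fin N) : ContinuousOn
      (fun x => fderiv ℝ (fun y => V y i) x (EuclideanSpace.single i 1)) U :=
    ((hcoord i).continuousOn_fderiv_of_isOpen hU le_rfl).clm_apply continuousOn_const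
  have hφ' (i : Fin N) : Continuous (fun x => fderiv ℝ φ x (EuclideanSpace.single i 1)) :=
    (hφ.continuous_fderiv (by norm_num)).clm_apply continuous_const
  have hc' (i : Fin N) : HasCompactSupport (fun x => fderiv ℝ φ x (EuclideanSpace.single i 1)) :=
    hc.fderiv_apply ℝ _
  have hsupp' (i : Fin N) :
      tsupport (fun x => fderiv ℝ φ x (EuclideanSpace.single i 1)) ⊆ U :=
    (tsupport_fderiv_apply_subset ℝ _).trans hsupp
  have hL (x : EuclideanSpace ℝ (Fin N)) : ⟪V x, gradient φ x⟫
      = ∑ i, V x i * fderiv ℝ φ x (EuclideanSpace.single i 1) := by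
    rw [inner_gradient_right]
    conv_lhs => rw [← (EuclideanSpace.basisFun (Fin N) ℝ).sum_repr (V x)]
    simp
  have hR (x : EuclideanSpace ℝ (Fin N)) : divergence V x * φ x
      = ∑ i, fderiv ℝ (fun y => V y i) x (EuclideanSpace.single i 1) * φ x := by
    by_cases hx : x ∈ tsupport φ
    · have hd : DifferentiableAt ℝ V x :=
        (hV.contDiffAt (hU.mem_nhds (hsupp hx))).differentiableAt (by norm_num)
      rw [divergence, Finset.sum_mul]
      refine Finset.sum_congr rfl fun i _ => ?_
      have := ((EuclideanSpace.proj (𝕜 := ℝ) i).hasFDerivAt.comp x hd.hasFDerivAt).fderiv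
      rw [show (fun y => V y i) = (EuclideanSpace.proj (𝕜 := ℝ) i) ∘ V from rfl, this]
      rfl
    · simp [image_eq_zero_of_notMem_tsupport hx]
  simp_rw [hL, hR]
  rw [integral_finsetSum, integral_finsetSum, ← Finset.sum_neg_distrib]
  · refine Finset.sum_congr rfl fun i _ => ?_
    refine integral_mul_fderiv_eq_neg_fderiv_mul_of_integrable ?_ ?_ ?_ ?_ ?_
    · exact integrable_mul_of_tsupport_subset hU (hderiv i) hφ.continuous hc hsupp
    · exact integrable_mul_of_tsupport_subset hU (hcoord i).continuousOn (hφ' i) (hc' i) (hsupp' i)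
    · exact integrable_mul_of_tsupport_subset hU (hcoord i).continuousOn hφ.continuous hc hsupp
    · exact fun x hx => ((hcoord i).contDiffAt (hU.mem_nhds (hsupp hx))).differentiableAt
        (by norm_num)
    · exact fun x _ => hφ.differentiable (by norm_num) x
  · exact fun i _ => integrable_mul_of_tsupport_subset hU (hderiv i) hφ.continuous hc hsupp
  · exact fun i _ =>
      integrable_mul_of_tsupport_subset hU (hcoord i).continuousOn (hφ' i) (hc' i) (hsupp' i)

lemma hasDerivAt_max_zero_sq (y : ℝ) :
    HasDerivAt (fun y : ℝ => max y 0 ^ 2) (2 * max y 0) y := by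
  rcases lt_trichotomy y 0 with hy | rfl | hy
  · have h : (fun y : ℝ => max y 0 ^ 2) =ᶠ[𝓝 y] fun _ => 0 := by
      filter_upwards [gt_mem_nhds hy] with z hz
      simp [max_eq_right hz.le]
    simpa [max_eq_right hy.le] using (hasDerivAt_const y (0 : ℝ)).congr_of_eventuallyEq h
  · rw [hasDerivAt_iff_isLittleO_nhds_zero]
    have h : (fun h : ℝ => h ^ 2) =o[𝓝 0] fun h => h := by
      simpa using Asymptotics.isLittleO_pow_pow (𝕜 := ℝ) (show 1 < 2 by norm_num)
    refine (Asymptotics.IsBigO.of_bound 1 (Eventually.of_forall fun z => ?_)).trans_isLittleO h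
    rcases le_total z 0 with hz | hz <;> simp [hz, sq_nonneg]
  · have h : (fun y : ℝ => max y 0 ^ 2) =ᶠ[𝓝 y] fun y => y ^ 2 := by
      filter_upwards [lt_mem_nhds hy] with z hz
      simp [max_eq_left hz.le]
    simpa [max_eq_left hy.le] using (hasDerivAt_pow 2 y).congr_of_eventuallyEq h

lemma contDiff_max_zero_sq : ContDiff ℝ 1 (fun y : ℝ => max y 0 ^ 2) := by
  rw [contDiff_one_iff_deriv]
  refine ⟨fun y => (hasDerivAt_max_zero_sq y).differentiableAt, ?_⟩
  rw [show deriv (fun y : ℝ => max y 0 ^ 2) = fun y => 2 * max y 0 from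
    funext fun y => (hasDerivAt_max_zero_sq y).deriv]
  fun_prop

/-- A `C¹` bump built from the squared positive part of `h`, with gradient pointing along `∇h`. -/
lemma exists_bump_inner_gradient_nonneg {h : EuclideanSpace ℝ (Fin N) → ℝ}
    {x₀ : EuclideanSpace ℝ (Fin N)} {r : ℝ} (hr : 0 < r)
    (hh : ContDiffOn ℝ 1 h (Metric.ball x₀ r)) (hpos : 0 < h x₀)
    (hneg : ∀ x ∈ Metric.ball x₀ r, r / 2 < dist x x₀ → h x ≤ 0) :
    ∃ φ : EuclideanSpace ℝ (Fin N) → ℝ, ContDiff ℝ 1 φ ∧ HasCompactSupport φ ∧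
      tsupport φ ⊆ Metric.ball x₀ r ∧ (∀ x, 0 ≤ φ x) ∧ φ x₀ ≠ 0 ∧
      ∀ x, 0 ≤ ⟪gradient h x, gradient φ x⟫ := by
  classical
  set φ : EuclideanSpace ℝ (Fin N) → ℝ :=
    fun x => if x ∈ Metric.ball x₀ r then max (h x) 0 ^ 2 else 0 with hφ
  have hts : tsupport φ ⊆ Metric.closedBall x₀ (r / 2) := by
    refine closure_minimal (fun x hx => ?_) Metric.isClosed_closedBall
    by_contra hx'
    rw [Metric.mem_closedBall, not_le] at hx'
    apply hx
    by_cases hb : x ∈ Metric.ball x₀ r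
    · simp [hφ, max_eq_right (hneg x hb hx')]
    · simp only [hφ, if_neg hb]
  have hsub : tsupport φ ⊆ Metric.ball x₀ r :=
    hts.trans (Metric.closedBall_subset_ball (by linarith))
  have hloc (x) (hx : x ∈ Metric.ball x₀ r) : φ =ᶠ[𝓝 x] (fun y => max y 0 ^ 2) ∘ h := by
    filter_upwards [Metric.isOpen_ball.mem_nhds hx] with y hy
    simp only [hφ, if_pos hy, Function.comp]
  have hat (x) (hx : x ∈ Metric.ball x₀ r) : ContDiffAt ℝ 1 h x :=
    hh.contDiffAt (Metric.isOpen_ball.mem_nhds hx)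
  refine ⟨φ, contDiff_iff_contDiffAt.2 fun x => ?_, ?_, hsub, fun x => ?_, ?_, fun x => ?_⟩
  · by_cases hx : x ∈ tsupport φ
    · exact (contDiff_max_zero_sq.contDiffAt.comp x (hat x (hsub hx))).congr_of_eventuallyEq
        (hloc x (hsub hx))
    · exact (contDiffAt_const (c := (0 : ℝ))).congr_of_eventuallyEq
        (notMem_tsupport_iff_eventuallyEq.1 hx)
  · exact (isCompact_closedBall x₀ (r / 2)).of_isClosed_subset (isClosed_tsupport φ) hts
  · simp only [hφ]
    split_ifs <;> positivity
  · simp [hφ, hr, max_eq_left hpos.le, hpos.ne']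
  · by_cases hx : x ∈ tsupport φ
    · have hd : DifferentiableAt ℝ h x := (hat x (hsub hx)).differentiableAt (by norm_num)
      have hcomp : HasFDerivAt φ ((2 * max (h x) 0) • fderiv ℝ h x) x :=
        ((hasDerivAt_max_zero_sq (h x)).comp_hasFDerivAt x hd.hasFDerivAt).congr_of_eventuallyEq
          (hloc x (hsub hx))
      rw [inner_gradient_right, hcomp.fderiv]
      simp only [smul_apply, ← inner_gradient_left, real_inner_self_eq_norm_sq,
        smul_eq_mul, conj_trivial]
      positivity
    · rw [inner_gradient_right, image_eq_zero_of_notMem_tsupport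
        (fun hx' => hx (tsupport_fderiv_subset ℝ hx'))]
      simp

/-- If `u` is a `C¹` function whose weak Laplacian is the continuous function `g`, and `w` is a
`C²` function (with gradient `V`) touching `u` from above at `x₀`, then `g x₀ ≤ Δw x₀`. -/
theorem le_divergence_of_touching_above {u g w : EuclideanSpace ℝ (Fin N) → ℝ}
    {V : EuclideanSpace ℝ (Fin N) → EuclideanSpace ℝ (Fin N)} {x₀ : EuclideanSpace ℝ (Fin N)}
    (hU : IsOpen U) (hu : ContDiffOn ℝ 1 u U) (hg : ContinuousOn g U)
    (hweak : ∀ φ : EuclideanSpace ℝ (Fin N) → ℝ, ContDiff ℝ 1 φ → HasCompactSupport φ →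
      tsupport φ ⊆ U → ∫ x, ⟪gradient u x, gradient φ x⟫ = -∫ x, g x * φ x)
    (hw : ∀ x ∈ U, HasGradientAt w (V x) x) (hV : ContDiffOn ℝ 1 V U)
    (hx₀ : x₀ ∈ U) (hle : ∀ x ∈ U, u x ≤ w x) (heq : u x₀ = w x₀) :
    g x₀ ≤ divergence V x₀ := by
  by_contra! hlt
  obtain ⟨ε, hε, hεlt⟩ : ∃ ε : ℝ, 0 < ε ∧ divergence V x₀ + 2 * ε * N < g x₀ := by
    refine ⟨(g x₀ - divergence V x₀) / (2 * (N + 1)), by have := sub_pos.2 hlt; positivity, ?_⟩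
    have hN : (0 : ℝ) < N + 1 := by positivity
    have : 2 * ((g x₀ - divergence V x₀) / (2 * (N + 1))) * N
        = (g x₀ - divergence V x₀) - (g x₀ - divergence V x₀) / (N + 1) := by
      field_simp
      ring
    have h2 : 0 < (g x₀ - divergence V x₀) / (N + 1) := div_pos (sub_pos.2 hlt) hN
    linarith
  set V' : EuclideanSpace ℝ (Fin N) → EuclideanSpace ℝ (Fin N) :=
    fun x => V x + (2 * ε) • (x - x₀) with hV'
  have hV'C : ContDiffOn ℝ 1 V' U := hV.add (by fun_prop)
  have hdiv (x) (hx : x ∈ U) : divergence V' x = divergence V x + 2 * ε * N := by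
    have hd : DifferentiableAt ℝ V x :=
      (hV.contDiffAt (hU.mem_nhds hx)).differentiableAt (by norm_num)
    have hfd : fderiv ℝ V' x = fderiv ℝ V x + (2 * ε) • ContinuousLinearMap.id ℝ _ :=
      (hd.hasFDerivAt.add (((hasFDerivAt_id x).sub_const x₀).const_smul (2 * ε))).fderiv
    simp [divergence, hfd, Finset.sum_add_distrib]
    ring
  have hmem : {x | x ∈ U ∧ divergence V' x < g x} ∈ 𝓝 x₀ := by
    refine inter_mem (hU.mem_nhds hx₀) ?_
    have h1 := (continuousOn_divergence hU hV'C).continuousAt (hU.mem_nhds hx₀)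
    have h2 := hg.continuousAt (hU.mem_nhds hx₀)
    exact h1.eventually_lt h2 (by rw [hdiv x₀ hx₀]; exact hεlt)
  obtain ⟨r, hr, hball⟩ := Metric.mem_nhds_iff.1 hmem
  have hballU : Metric.ball x₀ r ⊆ U := fun x hx => (hball hx).1
  set h : EuclideanSpace ℝ (Fin N) → ℝ :=
    fun x => u x - (w x + ε * ‖x - x₀‖ ^ 2) + ε * (r / 2) ^ 2 with hh
  have hwC : ContDiffOn ℝ 1 w U := by
    refine (contDiffOn_succ_iff_fderiv_of_isOpen (n := 0) hU).2
      ⟨fun x hx => (hw x hx).differentiableAt.differentiableWithinAt, by simp, ?_⟩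
    refine contDiffOn_zero.2 (ContinuousOn.congr
      ((InnerProductSpace.toDual ℝ (EuclideanSpace ℝ (Fin N))).continuous.comp_continuousOn
        hV.continuousOn) fun x hx => ?_)
    exact (hasGradientAt_iff_hasFDerivAt.1 (hw x hx)).fderiv
  have hhC : ContDiffOn ℝ 1 h (Metric.ball x₀ r) := by
    have hn : ContDiff ℝ 1 (fun x : EuclideanSpace ℝ (Fin N) => ε * ‖x - x₀‖ ^ 2) :=
      contDiff_const.mul ((contDiff_id.sub contDiff_const).norm_sq ℝ)
    exact ((hu.mono hballU).sub ((hwC.mono hballU).add hn.contDiffOn)).add contDiffOn_const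
  obtain ⟨φ, hφ, hφc, hφsupp, hφ0, hφx, hφg⟩ :=
    exists_bump_inner_gradient_nonneg hr hhC (by simp [hh, heq]; positivity) (by
      intro x hx hd
      have h1 := hle x (hballU hx)
      have h2 : (r / 2) ^ 2 ≤ ‖x - x₀‖ ^ 2 := by
        rw [← dist_eq_norm]; gcongr
      have h3 := mul_le_mul_of_nonneg_left h2 hε.le
      simp only [hh]; linarith)
  have hφU := hφsupp.trans hballU
  have hgrad (x) (hx : x ∈ Metric.ball x₀ r) : gradient h x = gradient u x - V' x := by
    have hxU := hballU hx
    have hdu := ((hu.contDiffAt (hU.mem_nhds hxU)).differentiableAt (by norm_num)).hasGradientAt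
    have hn : HasFDerivAt (fun x => ‖x - x₀‖ ^ 2) _ x :=
      ((hasFDerivAt_id (𝕜 := ℝ) x).sub_const x₀).norm_sq
    refine HasGradientAt.gradient (hasGradientAt_iff_hasFDerivAt.2 ?_)
    refine (((hasGradientAt_iff_hasFDerivAt.1 hdu).sub ((hasGradientAt_iff_hasFDerivAt.1
      (hw x hxU)).add (hn.const_mul ε))).add_const (ε * (r / 2) ^ 2)).congr_fderiv
      (ContinuousLinearMap.ext fun y => ?_)
    simp [hV']
    ring
  have hinner_zero (x) (hx : x ∉ tsupport φ) (y : EuclideanSpace ℝ (Fin N)) :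
      ⟪y, gradient φ x⟫ = 0 := by
    rw [inner_gradient_right, image_eq_zero_of_notMem_tsupport
      (fun hx' => hx (tsupport_fderiv_subset ℝ hx'))]
    simp
  have hinner_int {F : EuclideanSpace ℝ (Fin N) → EuclideanSpace ℝ (Fin N)}
      (hF : ContinuousOn F U) : Integrable fun x => ⟪F x, gradient φ x⟫ := by
    refine Continuous.integrable_of_hasCompactSupport (continuous_of_tsupport fun x hx => ?_)
      (HasCompactSupport.intro hφc fun x hx => hinner_zero x hx _)
    have hxφ : x ∈ tsupport φ := by
      by_contra hx'
      refine hx' ((closure_minimal (fun y hy => ?_) (isClosed_tsupport φ)) hx)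
      by_contra hy'
      exact hy (hinner_zero y hy' _)
    have hgc := (continuousOn_gradient isOpen_univ hφ.contDiffOn).continuousAt
      (isOpen_univ.mem_nhds (Set.mem_univ x))
    exact (hF.continuousAt (hU.mem_nhds (hφU hxφ))).inner hgc
  have hdiff : ∫ x, ⟪gradient h x, gradient φ x⟫
      = -∫ x, (g x - divergence V' x) * φ x := by
    have h1 (x) : ⟪gradient h x, gradient φ x⟫
        = ⟪gradient u x, gradient φ x⟫ - ⟪V' x, gradient φ x⟫ := by
      by_cases hx : x ∈ tsupport φ
      · rw [hgrad x (hφsupp hx), inner_sub_left]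
      · simp [hinner_zero x hx]
    simp_rw [h1, sub_mul]
    rw [integral_sub (hinner_int (continuousOn_gradient hU hu)) (hinner_int hV'C.continuousOn),
      integral_sub (integrable_mul_of_tsupport_subset hU hg hφ.continuous hφc hφU)
        (integrable_mul_of_tsupport_subset hU (continuousOn_divergence hU hV'C) hφ.continuous
          hφc hφU), hweak φ hφ hφc hφU,
      integral_inner_gradient_eq_neg_integral_divergence_mul hU hV'C hφ hφc hφU]
    ring
  have hpos : 0 < ∫ x, (g x - divergence V' x) * φ x := by
    refine (continuous_mul_of_tsupport_subset hU (hg.sub (continuousOn_divergence hU hV'C))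
      hφ.continuous hφU).integral_pos_of_hasCompactSupport_nonneg_nonzero hφc.mul_left
      (fun x => ?_) (x := x₀) ?_
    · by_cases hx : x ∈ tsupport φ
      · exact mul_nonneg (sub_pos.2 (hball (hφsupp hx)).2).le (hφ0 x)
      · simp [image_eq_zero_of_notMem_tsupport hx]
    · exact mul_ne_zero (sub_pos.2 (hball (Metric.mem_ball_self hr)).2).ne' hφx
  have hnn : 0 ≤ ∫ x, ⟪gradient h x, gradient φ x⟫ := integral_nonneg hφg
  linarith

/-- At a point where `w` touches `u` from above, the gradients agree. -/
lemma gradient_eq_of_touching_above {u w : EuclideanSpace ℝ (Fin N) → ℝ}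
    {v x₀ : EuclideanSpace ℝ (Fin N)}
    (hU : IsOpen U) (hu : DifferentiableAt ℝ u x₀) (hw : HasGradientAt w v x₀)
    (hx₀ : x₀ ∈ U) (hle : ∀ x ∈ U, u x ≤ w x) (heq : u x₀ = w x₀) : gradient u x₀ = v := by
  have hmax : IsLocalMax (fun x => u x - w x) x₀ := by
    filter_upwards [hU.mem_nhds hx₀] with x hx
    have := hle x hx
    simp only [heq, sub_self]
    linarith
  have h0 := hmax.hasFDerivAt_eq_zero
    (hu.hasFDerivAt.sub (hasGradientAt_iff_hasFDerivAt.1 hw))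
  have hfd : fderiv ℝ u x₀ = InnerProductSpace.toDual ℝ _ v := sub_eq_zero.1 h0
  rw [gradient, hfd, LinearIsometryEquiv.symm_apply_apply]

end Touching

section Radial

variable {N : ℕ}

lemma hasFDerivAt_log_norm {x : EuclideanSpace ℝ (Fin N)} (hx : x ≠ 0) :
    HasFDerivAt (fun y : EuclideanSpace ℝ (Fin N) => log ‖y‖) ((‖x‖ ^ 2)⁻¹ • innerSL ℝ x) x := by
  have hn : ‖x‖ ^ 2 ≠ 0 := by simpa using hx
  have h := (((hasFDerivAt_id (𝕜 := ℝ) x).norm_sq).log hn).const_mul (1 / 2 : ℝ)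
  refine (h.congr_of_eventuallyEq (Eventually.of_forall fun y => ?_)).congr_fderiv
    (ContinuousLinearMap.ext fun y => ?_)
  · simp [Real.log_pow]
  · simp
    ring

lemma hasGradientAt_radial {W : ℝ → ℝ} {W' : ℝ} {x : EuclideanSpace ℝ (Fin N)} (hx : x ≠ 0)
    (hW : HasDerivAt W W' (log ‖x‖)) :
    HasGradientAt (fun y => W (log ‖y‖)) ((W' * (‖x‖ ^ 2)⁻¹) • x) x := by
  rw [hasGradientAt_iff_hasFDerivAt]
  refine (hW.comp_hasFDerivAt x (hasFDerivAt_log_norm hx)).congr_fderiv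
    (ContinuousLinearMap.ext fun y => ?_)
  simp
  ring

lemma divergence_radial_smul {A : ℝ → ℝ} {A' : ℝ} {x : EuclideanSpace ℝ (Fin N)} (hx : x ≠ 0)
    (hA : HasDerivAt A A' (log ‖x‖)) :
    divergence (fun y => A (log ‖y‖) • y) x = N * A (log ‖x‖) + A' := by
  have hn : ‖x‖ ^ 2 ≠ 0 := by simpa using hx
  have h := ((hA.comp_hasFDerivAt x (hasFDerivAt_log_norm hx)).smul (hasFDerivAt_id x)).fderiv
  have h' : fderiv ℝ (fun y => A (log ‖y‖) • y) x = _ := h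
  rw [divergence, h']
  simp [Finset.sum_add_distrib, EuclideanSpace.inner_single_right]
  have hs : ∑ i, A' * ((‖x‖ ^ 2)⁻¹ * x.ofLp i) * x.ofLp i = A' := by
    have : ‖x‖ ^ 2 = ∑ i, x.ofLp i ^ 2 := by simp [EuclideanSpace.norm_sq_eq]
    calc ∑ i, A' * ((‖x‖ ^ 2)⁻¹ * x.ofLp i) * x.ofLp i
        = A' * ((‖x‖ ^ 2)⁻¹ * ∑ i, x.ofLp i ^ 2) := by
          rw [Finset.mul_sum, Finset.mul_sum]
          exact Finset.sum_congr rfl fun i _ => by ring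
      _ = A' := by rw [← this, inv_mul_cancel₀ hn, mul_one]
  exact hs

end Radial

lemma abs_abs_add_rpow_sub_le {p : ℝ} (hp0 : 0 ≤ p) (hp1 : p ≤ 1) (a b : ℝ) :
    |(|a + b| ^ p - |b| ^ p)| ≤ |a| ^ p := by
  have key (c d : ℝ) : |c + d| ^ p ≤ |c| ^ p + |d| ^ p :=
    (rpow_le_rpow (abs_nonneg _) (abs_add_le c d) hp0).trans
      (Real.rpow_add_le_add_rpow (abs_nonneg _) (abs_nonneg _) hp0 hp1)
  have h1 := key a b
  have h2 := key (-a) (a + b)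
  rw [neg_add_cancel_left, abs_neg] at h2
  rw [abs_le]
  constructor <;> linarith

/-- The constant in the decay estimate produced by the barrier with exponent `k`. -/
def barrierConst (ρ lam τ β k : ℝ) : ℝ :=
  4 * k ^ 2 + 6 * k + 4 * k * |β + ρ| + |lam| * (2 * k) ^ (1 - τ)

lemma le_barrierConst_mul_of_logDeriv_ineq {ρ lam τ β k L σ X : ℝ} (hτ0 : 0 ≤ τ) (hτ1 : τ < 1)
    (hf : fRho ρ lam τ β ≤ 0) (hk : 0 < k) (hL : 1 ≤ L) (hd : 0 < L ^ 2 - σ ^ 2)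
    (h : X / (L ^ 2 - σ ^ 2) ^ 2 ≤ (2 * k * σ / (L ^ 2 - σ ^ 2) - β) ^ 2
      + (2 * k / (L ^ 2 - σ ^ 2) + 4 * k * σ ^ 2 / (L ^ 2 - σ ^ 2) ^ 2)
      - 2 * ρ * (2 * k * σ / (L ^ 2 - σ ^ 2) - β)
      + lam * |2 * k * σ / (L ^ 2 - σ ^ 2) - β| ^ (1 - τ)) :
    X ≤ barrierConst ρ lam τ β k * L ^ (3 + τ) := by
  set d := L ^ 2 - σ ^ 2 with hddef
  set m := 2 * k * σ / d with hm
  have hL0 : 0 < L := by linarith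
  have hσL : |σ| ≤ L := abs_le_of_sq_le_sq (by linarith) hL0.le
  have hdL : d ≤ L ^ 2 := by nlinarith [sq_nonneg σ]
  have hmd : m * d = 2 * k * σ := by rw [hm]; field_simp
  have hmdL : |m| * d ≤ 2 * k * L := by
    rw [← abs_of_pos hd, ← abs_mul, hmd, abs_mul, abs_of_pos (by positivity)]
    gcongr
  have hpow : lam * |m - β| ^ (1 - τ) - lam * |β| ^ (1 - τ) ≤ |lam| * |m| ^ (1 - τ) := by
    have h1 := abs_abs_add_rpow_sub_le (p := 1 - τ) (by linarith) (by linarith) m (-β)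
    rw [abs_neg, ← sub_eq_add_neg] at h1
    calc lam * |m - β| ^ (1 - τ) - lam * |β| ^ (1 - τ)
        = lam * (|m - β| ^ (1 - τ) - |β| ^ (1 - τ)) := by ring
      _ ≤ |lam| * |(|m - β| ^ (1 - τ) - |β| ^ (1 - τ))| := by
          rw [← abs_mul]; exact le_abs_self _
      _ ≤ _ := by gcongr
  have hcross : -2 * (β + ρ) * m ≤ 2 * |β + ρ| * |m| := by
    rw [mul_assoc, mul_assoc, ← abs_mul]
    linarith [neg_abs_le ((β + ρ) * m)]
  rw [fRho] at hf
  have hX : X / d ^ 2 ≤ m ^ 2 + (2 * k / d + 4 * k * σ ^ 2 / d ^ 2) + 2 * |β + ρ| * |m|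
      + |lam| * |m| ^ (1 - τ) := by
    nlinarith
  rw [div_le_iff₀ (by positivity)] at hX
  have hexp : (m ^ 2 + (2 * k / d + 4 * k * σ ^ 2 / d ^ 2) + 2 * |β + ρ| * |m|
      + |lam| * |m| ^ (1 - τ)) * d ^ 2 = 4 * k ^ 2 * σ ^ 2 + 2 * k * d + 4 * k * σ ^ 2
      + 2 * |β + ρ| * (|m| * d) * d + |lam| * (|m| ^ (1 - τ) * d ^ 2) := by
    have h1 : m ^ 2 * d ^ 2 = 4 * k ^ 2 * σ ^ 2 := by rw [← mul_pow, hmd]; ring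
    have h2 : (2 * k / d + 4 * k * σ ^ 2 / d ^ 2) * d ^ 2 = 2 * k * d + 4 * k * σ ^ 2 := by
      field_simp
    linear_combination h1 + h2
  have hlast : |m| ^ (1 - τ) * d ^ 2 ≤ (2 * k) ^ (1 - τ) * L ^ (3 + τ) := by
    calc |m| ^ (1 - τ) * d ^ 2 = (|m| * d) ^ (1 - τ) * d ^ (1 + τ) := by
          rw [mul_rpow (abs_nonneg _) hd.le, mul_assoc, ← rpow_add hd, ← rpow_natCast d 2]
          norm_num
      _ ≤ (2 * k * L) ^ (1 - τ) * (L ^ 2) ^ (1 + τ) := by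
          have : 0 ≤ 1 - τ := by linarith
          gcongr
      _ = (2 * k) ^ (1 - τ) * L ^ (3 + τ) := by
          rw [mul_rpow (by positivity) hL0.le, mul_assoc, ← rpow_natCast L 2, ← rpow_mul hL0.le,
            ← rpow_add hL0]
          push_cast
          ring_nf
  have hL3 : L ^ 3 ≤ L ^ (3 + τ) := by
    rw [← rpow_natCast L 3]
    exact rpow_le_rpow_of_exponent_le hL (by push_cast; linarith)
  have hL2 : L ^ 2 ≤ L ^ (3 + τ) :=
    (pow_le_pow_right₀ hL (by norm_num)).trans hL3
  have hσ2 : σ ^ 2 ≤ L ^ 2 := by linarith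
  have h3 : |m| * d * d ≤ 2 * k * L ^ 3 := by
    calc |m| * d * d ≤ 2 * k * L * L ^ 2 := by gcongr
      _ = 2 * k * L ^ 3 := by ring
  calc X ≤ 4 * k ^ 2 * σ ^ 2 + 2 * k * d + 4 * k * σ ^ 2
      + 2 * |β + ρ| * (|m| * d * d) + |lam| * (|m| ^ (1 - τ) * d ^ 2) := by
        exact hX.trans_eq (hexp.trans (by ring))
    _ ≤ 4 * k ^ 2 * L ^ (3 + τ) + 2 * k * L ^ (3 + τ) + 4 * k * L ^ (3 + τ)
      + 2 * |β + ρ| * (2 * k * L ^ (3 + τ)) + |lam| * ((2 * k) ^ (1 - τ) * L ^ (3 + τ)) := by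
        have a1 := hσ2.trans hL2
        have a2 := hdL.trans hL2
        have a3 : |m| * d * d ≤ 2 * k * L ^ (3 + τ) := h3.trans (by gcongr)
        gcongr
    _ = _ := by rw [barrierConst]; ring

section Solution

variable {N : ℕ} {ρ lam τ θ q : ℝ} {Ω : Set (EuclideanSpace ℝ (Fin N))}
  {u : EuclideanSpace ℝ (Fin N) → ℝ}

/-- The expression that `Δu` equals for a solution `u` of (E). -/
def laplacianSource (ρ lam τ θ q : ℝ) (u : EuclideanSpace ℝ (Fin N) → ℝ)
    (x : EuclideanSpace ℝ (Fin N)) : ℝ :=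
  ((N : ℝ) - 2 + 2 * ρ) * (⟪x, gradient u x⟫ / ‖x‖ ^ 2)
    - lam * Gt τ x (u x) (gradient u x) + ‖x‖ ^ θ * u x ^ q

lemma continuousOn_norm_rpow (p : ℝ) :
    ContinuousOn (fun x : EuclideanSpace ℝ (Fin N) => ‖x‖ ^ p) (Ω \ {0}) :=
  continuous_norm.continuousOn.rpow_const fun _ hx => Or.inl (norm_ne_zero_iff.2 hx.2)

lemma isOpen_diff_zero (hΩ : IsOpen Ω) : IsOpen (Ω \ {0}) :=
  hΩ.sdiff isClosed_singleton

lemma continuousOn_drift (hΩ : IsOpen Ω) (hu : PosC1 Ω u) :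
    ContinuousOn (fun x => ⟪x, gradient u x⟫ / ‖x‖ ^ 2) (Ω \ {0}) :=
  (continuousOn_id.inner (𝕜 := ℝ) (continuousOn_gradient (isOpen_diff_zero hΩ) hu.1)).div
    (by fun_prop) fun _ hx => pow_ne_zero 2 (norm_ne_zero_iff.2 hx.2)

lemma continuousOn_Gt (hτ1 : τ < 1) (hΩ : IsOpen Ω) (hu : PosC1 Ω u) :
    ContinuousOn (fun x => Gt τ x (u x) (gradient u x)) (Ω \ {0}) := by
  refine ((hu.1.continuousOn.rpow_const fun x hx => Or.inl (hu.2 x hx).ne').mul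
    ((continuousOn_gradient (isOpen_diff_zero hΩ) hu.1).norm.rpow_const
      fun x _ => Or.inr (by linarith))).div (continuousOn_norm_rpow _) fun x hx => ?_
  exact (rpow_pos_of_pos (norm_pos_iff.2 hx.2) _).ne'

lemma continuousOn_absorption (hu : PosC1 Ω u) :
    ContinuousOn (fun x => ‖x‖ ^ θ * u x ^ q) (Ω \ {0}) :=
  (continuousOn_norm_rpow θ).mul
    (hu.1.continuousOn.rpow_const fun x hx => Or.inl (hu.2 x hx).ne')

lemma continuousOn_laplacianSource (hτ1 : τ < 1) (hΩ : IsOpen Ω) (hu : PosC1 Ω u) :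
    ContinuousOn (laplacianSource ρ lam τ θ q u) (Ω \ {0}) :=
  ((continuousOn_const.mul (continuousOn_drift hΩ hu)).sub
    (continuousOn_const.mul (continuousOn_Gt hτ1 hΩ hu))).add (continuousOn_absorption hu)

lemma IsSolutionE.integral_inner_gradient (hτ1 : τ < 1) (hΩ : IsOpen Ω)
    (hu : IsSolutionE N ρ lam τ θ q Ω u) {φ : EuclideanSpace ℝ (Fin N) → ℝ}
    (hφ : ContDiff ℝ 1 φ) (hc : HasCompactSupport φ) (hsupp : tsupport φ ⊆ Ω \ {0}) :
    ∫ x, ⟪gradient u x, gradient φ x⟫ = -∫ x, laplacianSource ρ lam τ θ q u x * φ x := by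
  have h := hu.2 φ ⟨hφ, hc, hsupp⟩
  have hφ0 (x) (hx : x ∉ Ω \ {0}) : φ x = 0 :=
    image_eq_zero_of_notMem_tsupport fun hx' => hx (hsupp hx')
  have hmul (F : EuclideanSpace ℝ (Fin N) → ℝ) :
      ∫ x in Ω \ {0}, F x * φ x = ∫ x, F x * φ x :=
    setIntegral_eq_integral_of_forall_compl_eq_zero fun x hx => by simp [hφ0 x hx]
  have hgrad : ∫ x in Ω \ {0}, ⟪gradient u x, gradient φ x⟫
      = ∫ x, ⟪gradient u x, gradient φ x⟫ :=
    setIntegral_eq_integral_of_forall_compl_eq_zero fun x hx => by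
      rw [inner_gradient_right, image_eq_zero_of_notMem_tsupport
        (fun hx' => hx (hsupp (tsupport_fderiv_subset ℝ hx')))]
      simp
  rw [weakE, hgrad, hmul fun x => ⟪x, gradient u x⟫ / ‖x‖ ^ 2,
    hmul fun x => Gt τ x (u x) (gradient u x), hmul fun x => ‖x‖ ^ θ * u x ^ q] at h
  have hmul_int {F : EuclideanSpace ℝ (Fin N) → ℝ} (hF : ContinuousOn F (Ω \ {0})) :
      Integrable fun x => F x * φ x :=
    integrable_mul_of_tsupport_subset (isOpen_diff_zero hΩ) hF hφ.continuous hc hsupp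
  have hsum : ∫ x, laplacianSource ρ lam τ θ q u x * φ x
      = ((N : ℝ) - 2 + 2 * ρ) * (∫ x, ⟪x, gradient u x⟫ / ‖x‖ ^ 2 * φ x)
        - lam * (∫ x, Gt τ x (u x) (gradient u x) * φ x)
        + ∫ x, ‖x‖ ^ θ * u x ^ q * φ x := by
    have i1 := (hmul_int (continuousOn_drift hΩ hu.1)).const_mul ((N : ℝ) - 2 + 2 * ρ)
    have i2 := (hmul_int (continuousOn_Gt hτ1 hΩ hu.1)).const_mul lam
    have i3 := hmul_int (continuousOn_absorption (θ := θ) (q := q) hu.1)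
    rw [← integral_const_mul, ← integral_const_mul, ← integral_sub i1 i2]
    refine Eq.trans (integral_congr_ae (Eventually.of_forall fun x => ?_))
      (integral_add (i1.sub i2) i3)
    simp only [laplacianSource]
    ring
  rw [hsum]
  linarith

/-- The radial barrier, as a function of `t = log ‖x‖`: it blows up at `t = t₀ ± L`. -/
def barrier (β k M L t₀ t : ℝ) : ℝ := M * exp (-β * t) * (L ^ 2 - (t - t₀) ^ 2) ^ (-k)

/-- The logarithmic derivative of `barrier`. -/
def barrierLogDeriv (β k L t₀ t : ℝ) : ℝ := 2 * k * (t - t₀) / (L ^ 2 - (t - t₀) ^ 2) - β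

lemma hasDerivAt_barrier {β k M L t₀ t : ℝ} (hd : 0 < L ^ 2 - (t - t₀) ^ 2) :
    HasDerivAt (barrier β k M L t₀) (barrier β k M L t₀ t * barrierLogDeriv β k L t₀ t) t := by
  have hdd : HasDerivAt (fun t => L ^ 2 - (t - t₀) ^ 2) (-(2 * (t - t₀))) t := by
    simpa using (((hasDerivAt_id t).sub_const t₀).pow 2).const_sub (L ^ 2)
  have he : HasDerivAt (fun t => M * exp (-β * t)) (M * (exp (-β * t) * (-β))) t := by
    simpa using (((hasDerivAt_id t).const_mul (-β)).exp).const_mul M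
  refine (he.mul (hdd.rpow_const (p := -k) (Or.inl hd.ne'))).congr_deriv ?_
  rw [barrier, barrierLogDeriv, rpow_sub_one hd.ne']
  field_simp
  ring

lemma hasDerivAt_barrierLogDeriv {β k L t₀ t : ℝ} (hd : 0 < L ^ 2 - (t - t₀) ^ 2) :
    HasDerivAt (barrierLogDeriv β k L t₀) (2 * k / (L ^ 2 - (t - t₀) ^ 2)
      + 4 * k * (t - t₀) ^ 2 / (L ^ 2 - (t - t₀) ^ 2) ^ 2) t := by
  have hdd : HasDerivAt (fun t => L ^ 2 - (t - t₀) ^ 2) (-(2 * (t - t₀))) t := by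
    simpa using (((hasDerivAt_id t).sub_const t₀).pow 2).const_sub (L ^ 2)
  have hn : HasDerivAt (fun t => 2 * k * (t - t₀)) (2 * k) t := by
    simpa using ((hasDerivAt_id t).sub_const t₀).const_mul (2 * k)
  refine ((hn.div hdd hd.ne').sub_const β).congr_deriv ?_
  field_simp
  ring

/-- The radial coefficient of the gradient of the barrier. -/
def barrierCoeff (β k M L t₀ t : ℝ) : ℝ :=
  barrier β k M L t₀ t * barrierLogDeriv β k L t₀ t * exp (-2 * t)

lemma hasDerivAt_barrierCoeff {β k M L t₀ t : ℝ} (hd : 0 < L ^ 2 - (t - t₀) ^ 2) :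
    HasDerivAt (barrierCoeff β k M L t₀) (barrier β k M L t₀ t * exp (-2 * t) *
      (barrierLogDeriv β k L t₀ t ^ 2 + (2 * k / (L ^ 2 - (t - t₀) ^ 2)
        + 4 * k * (t - t₀) ^ 2 / (L ^ 2 - (t - t₀) ^ 2) ^ 2)
        - 2 * barrierLogDeriv β k L t₀ t)) t := by
  have he : HasDerivAt (fun t : ℝ => exp (-2 * t)) (exp (-2 * t) * (-2)) t := by
    simpa using ((hasDerivAt_id t).const_mul (-2 : ℝ)).exp
  refine (((hasDerivAt_barrier hd).mul (hasDerivAt_barrierLogDeriv hd)).mul he).congr_deriv ?_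
  simp only [Pi.mul_apply]
  ring

lemma contDiffAt_barrierCoeff {β k M L t₀ t : ℝ} (hd : 0 < L ^ 2 - (t - t₀) ^ 2) :
    ContDiffAt ℝ 1 (barrierCoeff β k M L t₀) t := by
  have hdd : ContDiffAt ℝ 1 (fun t => L ^ 2 - (t - t₀) ^ 2) t := by fun_prop
  have hp : ContDiffAt ℝ 1 (fun t => (L ^ 2 - (t - t₀) ^ 2) ^ (-k)) t :=
    hdd.rpow_const_of_ne hd.ne'
  have hl : ContDiffAt ℝ 1 (barrierLogDeriv β k L t₀) t :=
    ((show ContDiffAt ℝ 1 (fun t => 2 * k * (t - t₀)) t by fun_prop).div hdd hd.ne').sub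
      contDiffAt_const
  have hb : ContDiffAt ℝ 1 (barrier β k M L t₀) t :=
    (show ContDiffAt ℝ 1 (fun t => M * exp (-β * t)) t by fun_prop).mul hp
  exact (hb.mul hl).mul (show ContDiffAt ℝ 1 (fun t : ℝ => exp (-2 * t)) t by fun_prop)

lemma exp_neg_two_mul_log {r : ℝ} (hr : 0 < r) : exp (-2 * log r) = (r ^ 2)⁻¹ := by
  rw [neg_mul, exp_neg, two_mul, exp_add, exp_log hr, sq]

/-- A solution touched from above by the barrier of height `M` satisfies the differential
inequality of the barrier at the contact point, so `M` is bounded. -/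
lemma IsSolutionE.rpow_le_of_touching_barrier (hτ0 : 0 ≤ τ) (hτ1 : τ < 1) (hq : 1 < q)
    (hΩ : IsOpen Ω) (hf : fRho ρ lam τ ((θ + 2) / (q - 1)) ≤ 0)
    (hu : IsSolutionE N ρ lam τ θ q Ω u) {M L t₀ : ℝ} (hM : 0 < M) (hL : 1 ≤ L)
    {U : Set (EuclideanSpace ℝ (Fin N))} (hU : IsOpen U) (hUΩ : U ⊆ Ω \ {0})
    (hUd : ∀ x ∈ U, 0 < L ^ 2 - (log ‖x‖ - t₀) ^ 2)
    (hle : ∀ x ∈ U, u x ≤ barrier ((θ + 2) / (q - 1)) (2 / (q - 1)) M L t₀ (log ‖x‖))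
    {x₀ : EuclideanSpace ℝ (Fin N)} (hx₀ : x₀ ∈ U)
    (heq : u x₀ = barrier ((θ + 2) / (q - 1)) (2 / (q - 1)) M L t₀ (log ‖x₀‖)) :
    M ^ (q - 1) ≤ barrierConst ρ lam τ ((θ + 2) / (q - 1)) (2 / (q - 1)) * L ^ (3 + τ) := by
  have hq' : 0 < q - 1 := by linarith
  set β := (θ + 2) / (q - 1) with hβ
  set k := 2 / (q - 1) with hk
  set V : EuclideanSpace ℝ (Fin N) → EuclideanSpace ℝ (Fin N) :=
    fun x => barrierCoeff β k M L t₀ (log ‖x‖) • x with hV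
  have hne (x) (hx : x ∈ U) : x ≠ 0 := (hUΩ hx).2
  have hgrad (x) (hx : x ∈ U) :
      HasGradientAt (fun y => barrier β k M L t₀ (log ‖y‖)) (V x) x := by
    have h := hasGradientAt_radial (hne x hx) (hasDerivAt_barrier (β := β) (k := k) (M := M)
      (hUd x hx))
    rwa [← exp_neg_two_mul_log (norm_pos_iff.2 (hne x hx))] at h
  have hVC : ContDiffOn ℝ 1 V U := fun x hx => by
    have hlog : ContDiffAt ℝ 1 (fun y : EuclideanSpace ℝ (Fin N) => log ‖y‖) x :=
      (contDiffAt_norm ℝ (hne x hx)).log (norm_ne_zero_iff.2 (hne x hx))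
    exact (((contDiffAt_barrierCoeff (hUd x hx)).comp x hlog).smul contDiffAt_id).contDiffWithinAt
  have hlap := le_divergence_of_touching_above hU (hu.1.1.mono hUΩ)
    ((continuousOn_laplacianSource (ρ := ρ) (lam := lam) (θ := θ) (q := q) hτ1 hΩ hu.1).mono hUΩ)
    (fun φ hφ hc hs => hu.integral_inner_gradient hτ1 hΩ hφ hc (hs.trans hUΩ))
    hgrad hVC hx₀ hle heq
  have hgu : gradient u x₀ = V x₀ :=
    gradient_eq_of_touching_above hU
      ((hu.1.1.contDiffAt ((isOpen_diff_zero hΩ).mem_nhds (hUΩ hx₀))).differentiableAt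
        (by norm_num)) (hgrad x₀ hx₀) hx₀ hle heq
  have hd := hUd x₀ hx₀
  have hr : 0 < ‖x₀‖ := norm_pos_iff.2 (hne x₀ hx₀)
  have hupos : 0 < u x₀ := hu.1.2 x₀ (hUΩ hx₀)
  rw [divergence_radial_smul (hne x₀ hx₀) (hasDerivAt_barrierCoeff hd)] at hlap
  have hVx : V x₀ = barrierCoeff β k M L t₀ (log ‖x₀‖) • x₀ := rfl
  rw [laplacianSource, hgu, Gt, hVx, barrierCoeff, ← heq, exp_neg_two_mul_log hr,
    real_inner_smul_right, real_inner_self_eq_norm_sq, norm_smul, Real.norm_eq_abs] at hlap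
  have hupow : u x₀ ^ (q - 1) * (‖x₀‖ ^ (θ + 2) * (L ^ 2 - (log ‖x₀‖ - t₀) ^ 2) ^ 2)
      = M ^ (q - 1) := by
    rw [heq, barrier, mul_rpow (by positivity) (by positivity), mul_rpow hM.le (exp_pos _).le,
      ← rpow_mul hd.le, ← exp_mul, rpow_def_of_pos hr (θ + 2)]
    rw [show -k * (q - 1) = -2 by rw [hk]; field_simp,
      show -β * log ‖x₀‖ * (q - 1) = -(log ‖x₀‖ * (θ + 2)) by rw [hβ]; field_simp,
      exp_neg, rpow_neg hd.le]
    have := exp_pos (log ‖x₀‖ * (θ + 2))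
    rw [rpow_ofNat]
    field_simp
  refine le_barrierConst_mul_of_logDeriv_ineq hτ0 hτ1 hf (by positivity) hL hd ?_
  change _ ≤ barrierLogDeriv β k L t₀ (log ‖x₀‖) ^ 2 + _
    - 2 * ρ * barrierLogDeriv β k L t₀ (log ‖x₀‖)
    + lam * |barrierLogDeriv β k L t₀ (log ‖x₀‖)| ^ (1 - τ)
  rw [← hupow]
  generalize barrierLogDeriv β k L t₀ (log ‖x₀‖) = ℓ at *
  generalize 2 * k / (L ^ 2 - (log ‖x₀‖ - t₀) ^ 2)
        + 4 * k * (log ‖x₀‖ - t₀) ^ 2 / (L ^ 2 - (log ‖x₀‖ - t₀) ^ 2) ^ 2 = ℓ' at *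
  generalize hX : u x₀ = W at *
  generalize ‖x₀‖ = r at *
  have hG : W ^ τ * (|W * ℓ * (r ^ 2)⁻¹| * r) ^ (1 - τ) / r ^ (τ + 1)
      = W / r ^ 2 * |ℓ| ^ (1 - τ) := by
    have h1 : |W * ℓ * (r ^ 2)⁻¹| * r = W * (|ℓ| * r⁻¹) := by
      rw [abs_mul, abs_mul, abs_of_pos hupos, abs_of_pos (show 0 < (r ^ 2)⁻¹ by positivity)]
      field_simp
    rw [h1, mul_rpow hupos.le (by positivity), mul_rpow (abs_nonneg _) (by positivity),
      inv_rpow hr.le, ← mul_assoc, ← rpow_add hupos, ← rpow_neg hr.le, mul_div_assoc,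
      mul_div_assoc, ← rpow_sub hr, show τ + (1 - τ) = 1 by ring,
      show -(1 - τ) - (τ + 1) = -(2 : ℝ) by ring, rpow_neg hr.le, rpow_one, rpow_ofNat]
    ring
  have hWq : r ^ θ * W ^ q = W / r ^ 2 * (W ^ (q - 1) * r ^ (θ + 2)) := by
    rw [rpow_sub_one hupos.ne', rpow_add hr, rpow_ofNat]
    field_simp
  rw [hG, hWq] at hlap
  have hc : 0 < W / r ^ 2 := by positivity
  have hL' : W ^ (q - 1) * (r ^ (θ + 2) * (L ^ 2 - (log r - t₀) ^ 2) ^ 2)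
      / (L ^ 2 - (log r - t₀) ^ 2) ^ 2 = W ^ (q - 1) * r ^ (θ + 2) := by
    field_simp
  rw [hL']
  refine le_of_mul_le_mul_left ?_ hc
  have h2 : ((N : ℝ) - 2 + 2 * ρ) * (W * ℓ * (r ^ 2)⁻¹ * r ^ 2 / r ^ 2)
      = W / r ^ 2 * ((N - 2 + 2 * ρ) * ℓ) := by
    field_simp
  have h3 : W * (r ^ 2)⁻¹ = W / r ^ 2 := rfl
  have h4 : (N : ℝ) * (W * ℓ * (r ^ 2)⁻¹) = W / r ^ 2 * (N * ℓ) := by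
    field_simp
  rw [h2, h3, h4] at hlap
  linarith

end Solution

/-- Decay estimate: at a point where the annulus of logarithmic half-width `L` fits in `Ω`. -/
lemma IsSolutionE.rpow_norm_mul_le {N : ℕ} {ρ lam τ θ q : ℝ}
    {Ω : Set (EuclideanSpace ℝ (Fin N))} {u : EuclideanSpace ℝ (Fin N) → ℝ}
    (hτ0 : 0 ≤ τ) (hτ1 : τ < 1) (hq : 1 < q)
    (hΩ : IsOpen Ω) (hf : fRho ρ lam τ ((θ + 2) / (q - 1)) ≤ 0)
    (hu : IsSolutionE N ρ lam τ θ q Ω u) {L : ℝ} (hL : 1 ≤ L)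
    {x₁ : EuclideanSpace ℝ (Fin N)} (hx₁ : x₁ ≠ 0)
    (hsub : ∀ x : EuclideanSpace ℝ (Fin N), ‖x‖ ≤ ‖x₁‖ * exp L → x ∈ Ω) :
    (‖x₁‖ ^ ((θ + 2) / (q - 1)) * u x₁) ^ (q - 1)
      ≤ barrierConst ρ lam τ ((θ + 2) / (q - 1)) (2 / (q - 1)) * L ^ (τ - 1) := by
  have hq' : 0 < q - 1 := by linarith
  have hL0 : 0 < L := by linarith
  have hr₁ : 0 < ‖x₁‖ := norm_pos_iff.2 hx₁
  set β := (θ + 2) / (q - 1) with hβ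
  set k := 2 / (q - 1) with hk
  have hk0 : 0 < k := by positivity
  set t₀ := log ‖x₁‖ with ht₀
  set K : Set (EuclideanSpace ℝ (Fin N)) :=
    {x | ‖x₁‖ * exp (-L) ≤ ‖x‖ ∧ ‖x‖ ≤ ‖x₁‖ * exp L} with hK
  have hKne (x) (hx : x ∈ K) : x ≠ 0 :=
    norm_pos_iff.1 ((mul_pos hr₁ (exp_pos _)).trans_le hx.1)
  have hKΩ : K ⊆ Ω \ {0} := fun x hx => ⟨hsub x hx.2, hKne x hx⟩
  have hKc : IsCompact K := by
    refine (isCompact_closedBall (0 : EuclideanSpace ℝ (Fin N)) (‖x₁‖ * exp L)).of_isClosed_subset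
      ?_ fun x hx => by simpa using hx.2
    exact (isClosed_le continuous_const continuous_norm).inter
      (isClosed_le continuous_norm continuous_const)
  set Q : EuclideanSpace ℝ (Fin N) → ℝ :=
    fun x => ‖x‖ ^ β * (L ^ 2 - (log ‖x‖ - t₀) ^ 2) ^ k * u x with hQ
  have hQc : ContinuousOn Q K := by
    have hlogc : ContinuousOn (fun x : EuclideanSpace ℝ (Fin N) => log ‖x‖) K :=
      continuous_norm.continuousOn.log fun x hx => norm_ne_zero_iff.2 (hKne x hx)
    exact (((continuousOn_norm_rpow (Ω := Ω) β).mono hKΩ).mul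
      ((continuousOn_const.sub ((hlogc.sub continuousOn_const).pow 2)).rpow_const
        fun _ _ => Or.inr hk0.le)).mul (hu.1.1.continuousOn.mono hKΩ)
  have hx₁K : x₁ ∈ K :=
    ⟨mul_le_of_le_one_right hr₁.le (exp_le_one_iff.2 (by linarith)),
      le_mul_of_one_le_right hr₁.le (one_le_exp hL0.le)⟩
  obtain ⟨x₀, hx₀K, hmax⟩ := hKc.exists_isMaxOn ⟨x₁, hx₁K⟩ hQc
  have hmax' (x) (hx : x ∈ K) : Q x ≤ Q x₀ := hmax hx
  have hQ₁ : Q x₁ = ‖x₁‖ ^ β * u x₁ * (L ^ 2) ^ k := by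
    simp only [hQ, ht₀, sub_self]
    norm_num
    ring
  have hu₁ : 0 < u x₁ := hu.1.2 x₁ (hKΩ hx₁K)
  have hM : 0 < Q x₀ := by
    refine lt_of_lt_of_le ?_ (hmax' x₁ hx₁K)
    rw [hQ₁]
    positivity
  set U : Set (EuclideanSpace ℝ (Fin N)) :=
    {x | ‖x₁‖ * exp (-L) < ‖x‖ ∧ ‖x‖ < ‖x₁‖ * exp L} with hU
  have hUK : U ⊆ K := fun x hx => ⟨hx.1.le, hx.2.le⟩
  have hUo : IsOpen U :=
    (isOpen_lt continuous_const continuous_norm).inter (isOpen_lt continuous_norm continuous_const)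
  have hUd (x) (hx : x ∈ U) : 0 < L ^ 2 - (log ‖x‖ - t₀) ^ 2 := by
    have hx0 : 0 < ‖x‖ := norm_pos_iff.2 (hKne x (hUK hx))
    have h1 := log_lt_log (mul_pos hr₁ (exp_pos _)) hx.1
    have h2 := log_lt_log hx0 hx.2
    rw [log_mul hr₁.ne' (exp_pos _).ne', log_exp] at h1 h2
    have h3 : |log ‖x‖ - t₀| < L := abs_lt.2 ⟨by linarith, by linarith⟩
    exact sub_pos.2 (sq_lt_sq.2 (h3.trans_le (le_abs_self L)))
  have hx₀U : x₀ ∈ U := by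
    have hd0 : L ^ 2 - (log ‖x₀‖ - t₀) ^ 2 ≠ 0 := by
      intro h0
      simp only [hQ, h0, zero_rpow hk0.ne', mul_zero, zero_mul, lt_irrefl] at hM
    refine ⟨lt_of_le_of_ne hx₀K.1 fun h => hd0 ?_, lt_of_le_of_ne hx₀K.2 fun h => hd0 ?_⟩
    · rw [← h, log_mul hr₁.ne' (exp_pos _).ne', log_exp]
      ring
    · rw [h, log_mul hr₁.ne' (exp_pos _).ne', log_exp]
      ring
  have hbar (x) (hx : x ∈ U) (M : ℝ) : barrier β k M L t₀ (log ‖x‖)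
      = M / (‖x‖ ^ β * (L ^ 2 - (log ‖x‖ - t₀) ^ 2) ^ k) := by
    have hx0 : 0 < ‖x‖ := norm_pos_iff.2 (hKne x (hUK hx))
    rw [barrier, rpow_neg (hUd x hx).le, rpow_def_of_pos hx0 β,
      show -β * log ‖x‖ = -(log ‖x‖ * β) by ring, exp_neg]
    field_simp
  have hden (x) (hx : x ∈ U) : 0 < ‖x‖ ^ β * (L ^ 2 - (log ‖x‖ - t₀) ^ 2) ^ k := by
    have hx0 : 0 < ‖x‖ := norm_pos_iff.2 (hKne x (hUK hx))
    have := hUd x hx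
    positivity
  have hbound := hu.rpow_le_of_touching_barrier hτ0 hτ1 hq hΩ hf hM hL hUo (hUK.trans hKΩ) hUd
    (fun x hx => by
      rw [hbar x hx, le_div_iff₀ (hden x hx), mul_comm]
      exact hmax' x (hUK hx))
    hx₀U (by
      rw [hbar x₀ hx₀U, eq_div_iff (hden x₀ hx₀U).ne', mul_comm])
  have hle : ‖x₁‖ ^ β * u x₁ * (L ^ 2) ^ k ≤ Q x₀ := hQ₁ ▸ hmax' x₁ hx₁K
  have hpow := rpow_le_rpow (by positivity) hle hq'.le
  rw [mul_rpow (by positivity) (by positivity), ← rpow_mul (by positivity),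
    show k * (q - 1) = 2 by rw [hk]; field_simp, rpow_ofNat] at hpow
  have h4 : L ^ (3 + τ) = L ^ (τ - 1) * (L ^ 2) ^ 2 := by
    rw [← pow_mul, ← rpow_natCast L (2 * 2), ← rpow_add hL0]
    norm_num
    ring_nf
  have h5 := hpow.trans hbound
  rw [h4, ← mul_assoc] at h5
  exact le_of_mul_le_mul_right h5 (by positivity)

/-- If `f_ρ(β) ≤ 0`, then every positive solution `u` of (E) in `Ω \ {0}`
satisfies `|x|^β u(x) → 0` as `|x| → 0`. -/
theorem stmt14_vanishing
    (N : ℕ) (hN : 2 ≤ N) (ρ lam τ θ q : ℝ)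
    (hτ0 : 0 ≤ τ) (hτ1 : τ < 1) (hq : 1 < q)
    (Ω : Set (EuclideanSpace ℝ (Fin N))) (hΩ : IsOpen Ω) (h0 : (0 : EuclideanSpace ℝ (Fin N)) ∈ Ω)
    (hf : fRho ρ lam τ ((θ + 2) / (q - 1)) ≤ 0)
    (u : EuclideanSpace ℝ (Fin N) → ℝ)
    (hu : IsSolutionE N ρ lam τ θ q Ω u) :
    Filter.Tendsto (fun x : EuclideanSpace ℝ (Fin N) => ‖x‖ ^ ((θ + 2) / (q - 1)) * u x)
      (𝓝[≠] (0 : EuclideanSpace ℝ (Fin N))) (𝓝 0) := by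
  have hq' : 0 < q - 1 := by linarith
  obtain ⟨R, hR, hball⟩ := Metric.isOpen_iff.1 hΩ 0 h0
  have hpow (ε : ℝ) (hε : 0 < ε) : ∃ L : ℝ, 1 ≤ L ∧
      barrierConst ρ lam τ ((θ + 2) / (q - 1)) (2 / (q - 1)) * L ^ (τ - 1) < ε ^ (q - 1) := by
    have h1 : Tendsto (fun L : ℝ =>
        barrierConst ρ lam τ ((θ + 2) / (q - 1)) (2 / (q - 1)) * L ^ (τ - 1)) atTop (𝓝 0) := by
      have h2 := (tendsto_rpow_neg_atTop (show 0 < 1 - τ by linarith)).const_mul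
        (barrierConst ρ lam τ ((θ + 2) / (q - 1)) (2 / (q - 1)))
      simpa using h2
    exact ((eventually_ge_atTop 1).and
      (h1.eventually_lt_const (rpow_pos_of_pos hε (q - 1)))).exists
  rw [Metric.tendsto_nhdsWithin_nhds]
  intro ε hε
  obtain ⟨L, hL, hLε⟩ := hpow ε hε
  refine ⟨R * exp (-L), by positivity, fun {x} hx hxR => ?_⟩
  have hx0 : x ≠ 0 := hx
  rw [dist_zero_right] at hxR
  have hxL : ‖x‖ * exp L < R := by
    calc ‖x‖ * exp L < R * exp (-L) * exp L := by gcongr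
      _ = R := by rw [mul_assoc, ← exp_add, neg_add_cancel, exp_zero, mul_one]
  have hsub (y : EuclideanSpace ℝ (Fin N)) (hy : ‖y‖ ≤ ‖x‖ * exp L) : y ∈ Ω :=
    hball (by simpa using hy.trans_lt hxL)
  have hxΩ : x ∈ Ω := hsub x (le_mul_of_one_le_right (norm_nonneg _) (one_le_exp (by linarith)))
  have hnn : 0 ≤ ‖x‖ ^ ((θ + 2) / (q - 1)) * u x :=
    mul_nonneg (by positivity) (hu.1.2 x ⟨hxΩ, hx0⟩).le
  rw [Real.dist_0_eq_abs, abs_of_nonneg hnn]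
  exact (rpow_lt_rpow_iff hnn hε.le hq').1
    ((hu.rpow_norm_mul_le hτ0 hτ1 hq hΩ hf hL hx0 hsub).trans_lt hLε)


end
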